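/- Let Z_α (α a (p−1)-multi-index) be the normal vectors constructed from Nambu brackets, and Z_α^β = ḡ(Z_α, Z^β). Then: (i) Z^i_α Z^{jα} = ḡ^{ij} − γ⁻² (P²)^{ij}; (ii) Z_α^δ Z_δ^β = Z_α^β (Z is idempotent as a matrix over multi-indices); (iii) Z_α^α = p. -/

import Mathlib

open scoped BigOperators
noncomputable section

open Classical in
/-- The totally antisymmetric Levi-Civita symbol with `ε^{01⋯(n-1)} = 1`. -/
def eps {n : ℕ} (v : Fin n → Fin n) : ℝ :=
  if h : Function.Bijective v then ((Equiv.Perm.sign (Equiv.ofBijective v h) : ℤ) : ℝ) else 0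

/-- Partial derivative `∂_a f` of a function on the chart `ℝ^ν` of `Σ`. -/
def pd {ν : ℕ} (a : Fin ν) (f : (Fin ν → ℝ) → ℝ) (p : Fin ν → ℝ) : ℝ :=
  fderiv ℝ f p (Pi.single a 1)

/-- The Nambu bracket `{f₁,…,f_ν} = ρ⁻¹ ε^{a₁⋯a_ν} (∂_{a₁}f₁)⋯(∂_{a_ν}f_ν)`. -/
def nb {ν : ℕ} (ρ : (Fin ν → ℝ) → ℝ) (f : Fin ν → (Fin ν → ℝ) → ℝ) (p : Fin ν → ℝ) : ℝ :=
  (ρ p)⁻¹ * ∑ σ : Fin ν → Fin ν, eps σ * ∏ a : Fin ν, pd (σ a) (f a) p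

open Matrix in
lemma det_sub_rank_one {m : ℕ} (M : Matrix (Fin m) (Fin m) ℝ) (u v : Fin m → ℝ) :
    (M - vecMulVec u v).det = M.det - v ⬝ᵥ (M.adjugate *ᵥ u) := by
  have key : (fun t : ℝ => ((M + t • 1) - vecMulVec u v).det) =
      fun t : ℝ => (M + t • 1).det - v ⬝ᵥ ((M + t • 1).adjugate *ᵥ u) := by
    have hfin : {t : ℝ | (M + t • 1).det = 0}.Finite := by
      refine (Polynomial.finite_setOfPred_isRoot (p := (-M).charpoly)
        (Matrix.charpoly_monic _).ne_zero).subset ?_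
      intro t ht
      simp only [Set.mem_ofPred_eq, Polynomial.IsRoot.def, Matrix.eval_charpoly] at ht ⊢
      rw [← ht]
      congr 1
      rw [sub_neg_eq_add, add_comm, Matrix.smul_one_eq_diagonal]
      rfl
    have hd : Dense ({t : ℝ | (M + t • 1).det = 0}ᶜ) := hfin.countable.dense_compl ℝ
    have hc : Continuous fun t : ℝ => M + t • (1 : Matrix (Fin m) (Fin m) ℝ) := by fun_prop
    refine Continuous.ext_on hd ?_ ?_ ?_
    · exact (hc.sub continuous_const).matrix_det
    · refine hc.matrix_det.sub ?_
      exact Continuous.dotProduct continuous_const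
        (Continuous.matrix_mulVec hc.matrix_adjugate continuous_const)
    · intro t ht
      have hu : IsUnit (M + t • (1 : Matrix (Fin m) (Fin m) ℝ)).det := isUnit_iff_ne_zero.2 ht
      have h := det_add_replicateCol_mul_replicateRow (ι := Unit) hu (-u) v
      have h1 : (M + t • (1 : Matrix (Fin m) (Fin m) ℝ)) - vecMulVec u v =
        (M + t • 1) + replicateCol Unit (-u) * replicateRow Unit v := by
        ext i j
        simp [Matrix.mul_apply, vecMulVec_apply, sub_eq_add_neg]
      simp only
      rw [h1, h, det_unique (n := Unit)]
      have h2 : (replicateRow Unit v * (M + t • (1 : Matrix (Fin m) (Fin m) ℝ))⁻¹ *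
          replicateCol Unit (-u)) default default =
          -(v ⬝ᵥ ((M + t • (1 : Matrix (Fin m) (Fin m) ℝ))⁻¹ *ᵥ u)) := by
        rw [Matrix.mul_assoc, Matrix.mul_apply_eq_vecMul]
        simp [vecMul, dotProduct, Matrix.mul_apply, mulVec]
      rw [Matrix.add_apply, h2, one_apply_eq, Matrix.inv_def, smul_mulVec, dotProduct_smul]
      rw [Ring.inverse_eq_inv', smul_eq_mul]
      have : (M + t • (1 : Matrix (Fin m) (Fin m) ℝ)).det ≠ 0 := ht
      field_simp
      ring
  simpa using congrFun key 0

/-- Gram matrix of two families of vectors. -/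
def grm {m N : ℕ} (W X : Fin m → Fin N → ℝ) : Matrix (Fin m) (Fin m) ℝ :=
  Matrix.of fun a b => W a ⬝ᵥ X b

/-- Standard basis vector. -/
def ee {N : ℕ} (i : Fin N) : Fin N → ℝ := Pi.single i 1

open Matrix in
lemma gram_step {m N : ℕ} (W W' : Fin m → Fin N → ℝ) :
    ∑ c : Fin N, (grm (Fin.snoc W (ee c) : Fin (m+1) → Fin N → ℝ)
      (Fin.snoc W' (ee c) : Fin (m+1) → Fin N → ℝ)).det = ((N : ℝ) - m) * (grm W W').det := by
  have h1 : ∀ c : Fin N, (grm (Fin.snoc W (ee c) : Fin (m+1) → Fin N → ℝ)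
      (Fin.snoc W' (ee c) : Fin (m+1) → Fin N → ℝ)).det =
      (grm W W').det - (fun b => W' b c) ⬝ᵥ ((grm W W').adjugate *ᵥ (fun a => W a c)) := by
    intro c
    rw [← det_sub_rank_one, ← Matrix.det_submatrix_equiv_self (finSumFinEquiv (m := m) (n := 1))]
    have : (grm (Fin.snoc W (ee c) : Fin (m+1) → Fin N → ℝ)
      (Fin.snoc W' (ee c) : Fin (m+1) → Fin N → ℝ)).submatrix (finSumFinEquiv (m := m) (n := 1))
        (finSumFinEquiv (m := m) (n := 1)) =
        fromBlocks (grm W W') (replicateCol (Fin 1) (fun a => W a c))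
          (replicateRow (Fin 1) (fun a => W' a c)) 1 := by
      have hs : ∀ (X : Fin m → Fin N → ℝ) (i : Fin m),
          (Fin.snoc X (ee c) : Fin (m+1) → Fin N → ℝ) (Fin.castAdd 1 i) = X i :=
        fun X i => Fin.snoc_castSucc (α := fun _ => Fin N → ℝ) _ _ _
      have hl : ∀ (X : Fin m → Fin N → ℝ) (i : Fin 1),
          (Fin.snoc X (ee c) : Fin (m+1) → Fin N → ℝ) (Fin.natAdd m i) = ee c := by
        intro X i
        have : Fin.natAdd m i = Fin.last m := by ext; simp
        rw [this]
        exact Fin.snoc_last (α := fun _ => Fin N → ℝ) _ _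
      ext i j
      rcases i with i | i <;> rcases j with j | j
      all_goals simp only [submatrix_apply, finSumFinEquiv_apply_left,
        finSumFinEquiv_apply_right, grm, of_apply, hs, hl, fromBlocks_apply₁₁,
        fromBlocks_apply₁₂, fromBlocks_apply₂₁, fromBlocks_apply₂₂]
      · simp [ee]
      · simp [ee]
      · rw [Subsingleton.elim i j]; simp [ee]
    rw [this, det_fromBlocks_one₂₂]
    congr 2
    ext i j
    simp [Matrix.mul_apply, vecMulVec_apply]
  simp_rw [h1]
  rw [Finset.sum_sub_distrib]
  have h2 : ∑ c : Fin N, (fun b => W' b c) ⬝ᵥ ((grm W W').adjugate *ᵥ (fun a => W a c)) =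
      m * (grm W W').det := by
    have h3 : trace ((grm W W').adjugate * grm W W') = m * (grm W W').det := by
      rw [adjugate_mul, trace_smul, trace_one]; simp [mul_comm]
    rw [← h3]
    simp only [dotProduct, mulVec, trace, diag, Matrix.mul_apply, grm, of_apply, Finset.mul_sum]
    rw [Finset.sum_comm]
    refine Finset.sum_congr rfl fun b _ => ?_
    rw [Finset.sum_comm]
    refine Finset.sum_congr rfl fun a _ => ?_
    refine Finset.sum_congr rfl fun c _ => ?_
    ring
  rw [h2]
  simp
  ring

lemma sum_snoc {N r : ℕ} (f : (Fin (r+1) → Fin N) → ℝ) :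
    ∑ c, f c = ∑ c : Fin r → Fin N, ∑ x : Fin N, f (Fin.snoc c x) := by
  rw [← (Fin.snocEquiv (fun _ : Fin (r+1) => Fin N)).sum_comp, Fintype.sum_prod_type,
    Finset.sum_comm]
  rfl

lemma gram_sum_cons {N : ℕ} (u u' : Fin N → ℝ) : ∀ r : ℕ,
    ∑ c : Fin r → Fin N, (grm (Fin.cons u (fun l => ee (c l)) : Fin (r+1) → Fin N → ℝ)
      (Fin.cons u' (fun l => ee (c l)) : Fin (r+1) → Fin N → ℝ)).det =
      (∏ t ∈ Finset.range r, ((N : ℝ) - (t + 1))) * (u ⬝ᵥ u') := by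
  intro r
  induction r with
  | zero => simp [grm]
  | succ r ih =>
    rw [sum_snoc, Finset.prod_range_succ, mul_right_comm, ← ih, Finset.sum_mul]
    refine Finset.sum_congr rfl fun c _ => ?_
    have := gram_step (Fin.cons u (fun l => ee (c l)) : Fin (r+1) → Fin N → ℝ)
      (Fin.cons u' (fun l => ee (c l)) : Fin (r+1) → Fin N → ℝ)
    push_cast at this
    rw [mul_comm, ← this]
    refine Finset.sum_congr rfl fun x _ => ?_
    have h : (fun l => (ee ((Fin.snoc c x : Fin (r+1) → Fin N) l) : Fin N → ℝ)) =
        Fin.snoc (fun l => ee (c l)) (ee x) := by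
      exact Fin.comp_snoc (α := Fin N) ee c x
    rw [h, Fin.cons_snoc_eq_snoc_cons, Fin.cons_snoc_eq_snoc_cons]

lemma gram_sum_append {N n : ℕ} (u u' : Fin N → ℝ) (V V' : Fin n → Fin N → ℝ) : ∀ r : ℕ,
    ∑ c : Fin r → Fin N,
      (grm (Fin.cons u (Fin.append V (fun l => ee (c l))) : Fin (n+r+1) → Fin N → ℝ)
      (Fin.cons u' (Fin.append V' (fun l => ee (c l))) : Fin (n+r+1) → Fin N → ℝ)).det =
      (∏ t ∈ Finset.range r, ((N : ℝ) - (n + t + 1))) *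
        (grm (Fin.cons u V : Fin (n+1) → Fin N → ℝ)
          (Fin.cons u' V' : Fin (n+1) → Fin N → ℝ)).det := by
  intro r
  induction r with
  | zero =>
    have h : ∀ (c : Fin 0 → Fin N) (X : Fin n → Fin N → ℝ),
      Fin.append X (fun l => (ee (c l) : Fin N → ℝ)) = X := by
      intro c X
      have : (fun l => (ee (c l) : Fin N → ℝ)) = Fin.elim0 := Subsingleton.elim _ _
      rw [this, Fin.append_elim0]; rfl
    simp only [h]
    simp
  | succ r ih =>
    rw [sum_snoc, Finset.prod_range_succ, mul_right_comm, ← ih, Finset.sum_mul]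
    refine Finset.sum_congr rfl fun c _ => ?_
    have := gram_step (Fin.cons u (Fin.append V (fun l => ee (c l))) : Fin (n+r+1) → Fin N → ℝ)
      (Fin.cons u' (Fin.append V' (fun l => ee (c l))) : Fin (n+r+1) → Fin N → ℝ)
    push_cast at this
    rw [mul_comm, ← this]
    refine Finset.sum_congr rfl fun x _ => ?_
    have h : (fun l => (ee ((Fin.snoc c x : Fin (r+1) → Fin N) l) : Fin N → ℝ)) =
        Fin.snoc (fun l => ee (c l)) (ee x) := by
      exact Fin.comp_snoc (α := Fin N) ee c x
    rw [h, Fin.append_snoc, Fin.append_snoc]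
    rw [← Fin.cons_snoc_eq_snoc_cons, ← Fin.cons_snoc_eq_snoc_cons]

lemma prod_fact (r : ℕ) (N : ℕ) (m : ℝ) (h : (N : ℝ) = m + r) :
    ∏ t ∈ Finset.range r, ((N : ℝ) - (m + t)) = r.factorial := by
  rw [← Finset.prod_range_reflect, ← Finset.prod_range_add_one_eq_factorial]
  push_cast
  refine Finset.prod_congr rfl fun t ht => ?_
  have : t + 1 ≤ r := Finset.mem_range.1 ht
  rw [h, Nat.sub_sub, Nat.cast_sub (by omega)]
  push_cast; ring

lemma mlin_expand {r N : ℕ} {κ : Type*} [Fintype κ] [DecidableEq κ]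
    (f : MultilinearMap ℝ (fun _ : Fin r => Fin N → ℝ) ℝ)
    (T : Fin r → κ → ℝ) (R : κ → Fin N → ℝ) :
    f (fun l => ∑ J, T l J • R J) = ∑ J : Fin r → κ, (∏ l, T l (J l)) * f (fun l => R (J l)) := by
  rw [MultilinearMap.map_sum]
  refine Finset.sum_congr rfl fun J _ => ?_
  rw [MultilinearMap.map_smul_univ f (fun l => T l (J l)) (fun l => R (J l)), smul_eq_mul]

lemma vec_expand {N : ℕ} (v : Fin N → ℝ) : v = ∑ i, v i • ee i := by
  ext j
  simp [ee, Finset.sum_apply, Pi.single_apply]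

lemma det_zero_rows {N : ℕ} (R : Fin N → Fin N → ℝ) {i j : Fin N} (hij : i ≠ j)
    (h : R i = R j) : Matrix.det (Matrix.of R) = 0 := Matrix.det_zero_of_row_eq hij h

lemma eps_eq_det {n : ℕ} (v : Fin n → Fin n) :
    eps v = Matrix.det (Matrix.of fun a => (ee (v a) : Fin n → ℝ)) := by
  unfold eps
  split_ifs with h
  · have := Matrix.det_permute (R := ℝ) (Equiv.ofBijective v h) 1
    rw [Matrix.det_one, mul_one] at this
    rw [← this]
    congr 1
    ext a b
    simp [ee, Matrix.one_apply, Pi.single_apply, eq_comm]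
  · have hi : ¬ Function.Injective v := fun hi => h (Finite.injective_iff_bijective.1 hi)
    simp only [Function.Injective, not_forall] at hi
    obtain ⟨a, b, hab, hne⟩ := hi
    refine (det_zero_rows _ hne ?_).symm
    simp only [hab]

lemma sum_eps {n : ℕ} (h : (Fin n → Fin n) → ℝ) :
    ∑ σ, eps σ * h σ = ∑ π : Equiv.Perm (Fin n), ((Equiv.Perm.sign π : ℤ) : ℝ) * h π := by
  symm
  refine Finset.sum_of_injOn (fun π => (π : Fin n → Fin n)) ?_ ?_ ?_ ?_
  · intro a _ b _ hab
    exact Equiv.coe_fn_injective hab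
  · intro a _; simp
  · intro σ _ hσ
    have : ¬ Function.Bijective σ := fun hb => hσ ⟨Equiv.ofBijective σ hb, by simp, rfl⟩
    rw [eps, dif_neg this, zero_mul]
  · intro π _
    have : Function.Bijective (π : Fin n → Fin n) := π.bijective
    have h2 : Equiv.ofBijective π this = π := by ext; rfl
    simp only [eps, this, dif_pos, h2]

/-- Determinant as a multilinear map in the rows. -/
def dm (N : ℕ) : MultilinearMap ℝ (fun _ : Fin N => Fin N → ℝ) ℝ :=
  (Matrix.detRowAlternating (n := Fin N) (R := ℝ)).toMultilinearMap

lemma dm_apply {N : ℕ} (R : Fin N → Fin N → ℝ) : dm N R = Matrix.det (Matrix.of R) := rfl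

lemma det_expand {n : ℕ} (A : Fin n → Fin n → ℝ) :
    ∑ σ : Fin n → Fin n, eps σ * ∏ a, A a (σ a) = Matrix.det (Matrix.of A) := by
  have h := mlin_expand (dm n) A (fun b => ee b)
  rw [← dm_apply]
  have h2 : (fun a => ∑ b, A a b • (ee b : Fin n → ℝ)) = A :=
    funext fun a => (vec_expand (A a)).symm
  rw [h2] at h
  rw [h]
  refine Finset.sum_congr rfl fun σ _ => ?_
  rw [eps_eq_det, dm_apply, mul_comm]

open Matrix in
lemma dm_mul {N : ℕ} (G : Matrix (Fin N) (Fin N) ℝ) (R : Fin N → Fin N → ℝ) :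
    dm N (fun i => G *ᵥ R i) = G.det * dm N R := by
  rw [dm_apply, dm_apply, mul_comm, ← det_transpose G]
  refine Eq.trans ?_ (det_mul _ _)
  congr 1
  ext i j
  rw [Matrix.mul_apply_eq_vecMul, vecMul_transpose]
  rfl

lemma nb_eq {ν : ℕ} (ρ : (Fin ν → ℝ) → ℝ) (f : Fin ν → (Fin ν → ℝ) → ℝ) (p : Fin ν → ℝ) :
    nb ρ f p = (ρ p)⁻¹ * Matrix.det (Matrix.of fun a b => pd b (f a) p) := by
  rw [nb, ← det_expand]

/-- det[u, V, w] -/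
def DD {n q : ℕ} (u : Fin (n + (q + 1)) → ℝ) (V : Fin n → Fin (n + (q + 1)) → ℝ)
    (w : Fin q → Fin (n + (q + 1)) → ℝ) : ℝ :=
  dm (n + q + 1) (Fin.cons u (Fin.append V w))

/-- multilinear in last slots -/
def DDw {n q : ℕ} (u : Fin (n + (q + 1)) → ℝ) (V : Fin n → Fin (n + (q + 1)) → ℝ) :
    MultilinearMap ℝ (fun _ : Fin q => Fin (n + (q + 1)) → ℝ) ℝ :=
  (((dm (n + q + 1)).curryLeft u).domDomCongr (finSumFinEquiv (m := n) (n := q)).symm).currySum V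

lemma DDw_apply {n q : ℕ} (u : Fin (n + (q + 1)) → ℝ) (V : Fin n → Fin (n + (q + 1)) → ℝ)
    (w : Fin q → Fin (n + (q + 1)) → ℝ) : DDw u V w = DD u V w := by
  unfold DDw DD
  rw [MultilinearMap.currySum_apply', MultilinearMap.domDomCongr_apply,
    MultilinearMap.curryLeft_apply]
  congr 2
  ext i
  refine Fin.addCases (fun i => ?_) (fun i => ?_) i <;> simp

/-- multilinear in middle slots -/
def DDV {n q : ℕ} (u : Fin (n + (q + 1)) → ℝ) (w : Fin q → Fin (n + (q + 1)) → ℝ) :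
    MultilinearMap ℝ (fun _ : Fin n => Fin (n + (q + 1)) → ℝ) ℝ :=
  (((dm (n + q + 1)).curryLeft u).domDomCongr
    ((finSumFinEquiv (m := n) (n := q)).symm.trans (Equiv.sumComm _ _))).currySum w

lemma DDV_apply {n q : ℕ} (u : Fin (n + (q + 1)) → ℝ) (V : Fin n → Fin (n + (q + 1)) → ℝ)
    (w : Fin q → Fin (n + (q + 1)) → ℝ) : DDV u w V = DD u V w := by
  unfold DDV DD
  rw [MultilinearMap.currySum_apply', MultilinearMap.domDomCongr_apply,
    MultilinearMap.curryLeft_apply]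
  congr 2
  ext i
  refine Fin.addCases (fun i => ?_) (fun i => ?_) i <;> simp

lemma DD_w {n q : ℕ} {κ : Type*} [Fintype κ] [DecidableEq κ] (u : Fin (n + (q + 1)) → ℝ)
    (V : Fin n → Fin (n + (q + 1)) → ℝ) (T : Fin q → κ → ℝ) (R : κ → Fin (n + (q + 1)) → ℝ) :
    ∑ J : Fin q → κ, (∏ l, T l (J l)) * DD u V (fun l => R (J l)) =
      DD u V (fun l => ∑ J, T l J • R J) := by
  simp only [← DDw_apply]
  rw [mlin_expand]

lemma DD_V {n q : ℕ} {κ : Type*} [Fintype κ] [DecidableEq κ] (u : Fin (n + (q + 1)) → ℝ)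
    (w : Fin q → Fin (n + (q + 1)) → ℝ) (T : Fin n → κ → ℝ) (R : κ → Fin (n + (q + 1)) → ℝ) :
    ∑ J : Fin n → κ, (∏ l, T l (J l)) * DD u (fun l => R (J l)) w =
      DD u (fun l => ∑ J, T l J • R J) w := by
  simp only [← DDV_apply]
  rw [mlin_expand]

lemma DD_u {n q : ℕ} (u : Fin (n + (q + 1)) → ℝ)
    (V : Fin n → Fin (n + (q + 1)) → ℝ) (w : Fin q → Fin (n + (q + 1)) → ℝ) :
    ∑ j, u j * DD (ee j) V w = DD u V w := by
  have h : ∀ u : Fin (n + (q + 1)) → ℝ,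
      DD u V w = (dm (n + q + 1)).curryLeft u (Fin.append V w) := fun u => rfl
  rw [h u]
  conv_rhs => rw [vec_expand u]
  rw [map_sum, sum_apply]
  refine Finset.sum_congr rfl fun j _ => ?_
  rw [map_smul, smul_apply, smul_eq_mul, h]

lemma DD_eq_zero {n q : ℕ} (V : Fin n → Fin (n + (q + 1)) → ℝ)
    (w : Fin q → Fin (n + (q + 1)) → ℝ) (a : Fin n) : DD (V a) V w = 0 := by
  unfold DD
  rw [dm_apply]
  refine det_zero_rows _ (i := 0) (j := Fin.succ (Fin.castAdd q a))
    (Fin.succ_ne_zero _).symm ?_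
  simp

lemma DD_perm {n q : ℕ} (u : Fin (n + (q + 1)) → ℝ) (V : Fin n → Fin (n + (q + 1)) → ℝ)
    (w : Fin q → Fin (n + (q + 1)) → ℝ) (π : Equiv.Perm (Fin n)) :
    DD u (fun a => V (π a)) w = ((Equiv.Perm.sign π : ℤ) : ℝ) * DD u V w := by
  let A : (Fin (n + (q + 1)) → ℝ) [⋀^Fin n]→ₗ[ℝ] ℝ :=
    { DDV u w with
      map_eq_zero_of_eq' := by
        intro V i j hV hij
        change DDV u w V = 0
        rw [DDV_apply, DD, dm_apply]
        refine det_zero_rows _ (i := Fin.succ (Fin.castAdd q i))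
          (j := Fin.succ (Fin.castAdd q j)) ?_ ?_
        · simpa using hij
        · simpa using hV }
  have hA : ∀ V, A V = DD u V w := fun V => DDV_apply u V w
  have := A.map_perm V π
  rw [hA, hA] at this
  change DD u (fun a => V (π a)) w = _ at this
  rw [this, Units.smul_def, zsmul_eq_mul]

lemma DD_eps {n q : ℕ} (j : Fin (n + (q + 1))) (k : Fin n → Fin (n + (q + 1)))
    (α : Fin q → Fin (n + (q + 1))) :
    eps (n := n + (q + 1)) (Fin.cons j (Fin.append k α)) =
      DD (ee j) (fun l => ee (k l)) (fun l => ee (α l)) := by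
  rw [eps_eq_det, DD, dm_apply]
  congr 2
  ext i
  refine Fin.cases ?_ (fun i => ?_) i
  · simp
  · refine Fin.addCases (fun i => ?_) (fun i => ?_) i <;> simp

open Matrix in
lemma DD_gram {n q : ℕ} (u u' : Fin (n + (q + 1)) → ℝ) (V V' : Fin n → Fin (n + (q + 1)) → ℝ) :
    ∑ c : Fin q → Fin (n + (q + 1)), DD u V (fun l => ee (c l)) * DD u' V' (fun l => ee (c l)) =
      q.factorial * (grm (Fin.cons u V : Fin (n + 1) → Fin (n + (q + 1)) → ℝ)
        (Fin.cons u' V' : Fin (n + 1) → Fin (n + (q + 1)) → ℝ)).det := by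
  have h := gram_sum_append u u' V V' q
  have h2 := prod_fact q (n + (q + 1)) (n + 1) (by push_cast; ring)
  rw [← h2]
  have h3 : ∀ t : ℕ, (n : ℝ) + 1 + t = n + t + 1 := fun t => by ring
  simp only [h3]
  rw [← h]
  refine Finset.sum_congr rfl fun c _ => ?_
  unfold DD
  rw [dm_apply, dm_apply, ← det_transpose (Matrix.of (Fin.cons u' _)), ← det_mul]
  rfl

open Matrix in
lemma DD_mul {n q : ℕ} (G : Matrix (Fin (n + (q + 1))) (Fin (n + (q + 1))) ℝ)
    (u : Fin (n + (q + 1)) → ℝ) (V : Fin n → Fin (n + (q + 1)) → ℝ)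
    (w : Fin q → Fin (n + (q + 1)) → ℝ) :
    DD (G *ᵥ u) (fun a => G *ᵥ V a) (fun a => G *ᵥ w a) = G.det * DD u V w := by
  unfold DD
  refine Eq.trans ?_ (dm_mul _ _)
  congr 1
  ext i j
  refine Fin.cases ?_ (fun i => ?_) i
  · simp
  · refine Fin.addCases (fun i => ?_) (fun i => ?_) i <;> simp

/-- det[u, w] -/
def CC {d : ℕ} (u : Fin (d + 1) → ℝ) (w : Fin d → Fin (d + 1) → ℝ) : ℝ :=
  dm (d + 1) (Fin.cons u w)

lemma CC_w {d : ℕ} {κ : Type*} [Fintype κ] [DecidableEq κ] (u : Fin (d + 1) → ℝ)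
    (T : Fin d → κ → ℝ) (R : κ → Fin (d + 1) → ℝ) :
    ∑ J : Fin d → κ, (∏ l, T l (J l)) * CC u (fun l => R (J l)) =
      CC u (fun l => ∑ J, T l J • R J) := by
  have h : ∀ w, CC u w = (dm (d + 1)).curryLeft u w := fun w => rfl
  simp only [h]
  rw [mlin_expand]

open Matrix in
lemma CC_gram {d : ℕ} (u u' : Fin (d + 1) → ℝ) :
    ∑ c : Fin d → Fin (d + 1), CC u (fun l => ee (c l)) * CC u' (fun l => ee (c l)) =
      d.factorial * (u ⬝ᵥ u') := by
  have h := gram_sum_cons u u' d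
  have h2 := prod_fact d (d + 1) 1 (by push_cast; ring)
  rw [← h2]
  simp only [add_comm (1 : ℝ)] at *
  rw [← h]
  refine Finset.sum_congr rfl fun c _ => ?_
  unfold CC
  rw [dm_apply, dm_apply, ← det_transpose (Matrix.of (Fin.cons u' _)), ← det_mul]
  rfl

open Matrix in
lemma CC_mul {d : ℕ} (G : Matrix (Fin (d + 1)) (Fin (d + 1)) ℝ)
    (u : Fin (d + 1) → ℝ) (w : Fin d → Fin (d + 1) → ℝ) :
    CC (G *ᵥ u) (fun a => G *ᵥ w a) = G.det * CC u w := by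
  unfold CC
  rw [← dm_mul]
  congr 1
  ext i j
  refine Fin.cases ?_ (fun i => ?_) i
  · simp
  · simp

open Matrix in
lemma bordered_det {n : ℕ} (M : Matrix (Fin (n + 1)) (Fin (n + 1)) ℝ)
    (g : Matrix (Fin n) (Fin n) ℝ) (hg : IsUnit g.det)
    (h : ∀ a b, M a.succ b.succ = g a b) :
    M.det = g.det * (M 0 0 - (fun b => M 0 b.succ) ⬝ᵥ (g⁻¹ *ᵥ fun a => M a.succ 0)) := by
  let e : Fin 1 ⊕ Fin n ≃ Fin (n + 1) :=
    (finSumFinEquiv (m := 1) (n := n)).trans (finCongr (add_comm 1 n))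
  have el : ∀ i, e (Sum.inl i) = 0 := by
    intro i; ext; simp [e]
  have er : ∀ i, e (Sum.inr i) = i.succ := by
    intro i; ext; simp [e]
  rw [← Matrix.det_submatrix_equiv_self e]
  have h1 : M.submatrix e e = fromBlocks (of fun _ _ => M 0 0) (of fun _ b => M 0 b.succ)
      (of fun a _ => M a.succ 0) g := by
    ext i j
    rcases i with i | i <;> rcases j with j | j <;> simp [el, er, h]
  let _ := g.invertibleOfIsUnitDet hg
  rw [h1, det_fromBlocks₂₂, Matrix.invOf_eq_nonsing_inv, det_unique (n := Fin 1)]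
  congr 1
  rw [Matrix.mul_assoc]
  rfl

open Matrix in
lemma sum_eps_nb {d q : ℕ} (ρ : (Fin (d + 1) → ℝ) → ℝ)
    (x : Fin ((d + 1) + (q + 1)) → (Fin (d + 1) → ℝ) → ℝ) (p : Fin (d + 1) → ℝ) (s : ℝ)
    (j : Fin ((d + 1) + (q + 1))) (α : Fin q → Fin ((d + 1) + (q + 1))) :
    ∑ k : Fin (d + 1) → Fin ((d + 1) + (q + 1)),
      (s * eps (n := (d + 1) + (q + 1)) (Fin.cons j (Fin.append k α))) *
            nb ρ (fun l => x (k l)) p =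
      s * (ρ p)⁻¹ * (d + 1).factorial *
        DD (ee j) (fun a i => pd a (x i) p) (fun l => ee (α l)) := by
  have h1 : ∀ k : Fin (d + 1) → Fin ((d + 1) + (q + 1)),
      (s * eps (n := (d + 1) + (q + 1)) (Fin.cons j (Fin.append k α))) *
            nb ρ (fun l => x (k l)) p =
      ∑ σ : Fin (d + 1) → Fin (d + 1), s * (ρ p)⁻¹ * (eps σ * ((∏ a, pd (σ a) (x (k a)) p) *
        DD (ee j) (fun l => ee (k l)) (fun l => ee (α l)))) := by
    intro k
    rw [DD_eps, nb, Finset.mul_sum, Finset.mul_sum]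
    refine Finset.sum_congr rfl fun σ _ => ?_
    ring
  simp_rw [h1]
  rw [Finset.sum_comm]
  simp_rw [← Finset.mul_sum]
  have h2 : ∀ σ : Fin (d + 1) → Fin (d + 1),
      ∑ k : Fin (d + 1) → Fin ((d + 1) + (q + 1)), (∏ a, pd (σ a) (x (k a)) p) *
        DD (ee j) (fun l => ee (k l)) (fun l => ee (α l)) =
      DD (ee j) (fun a i => pd (σ a) (x i) p) (fun l => ee (α l)) := by
    intro σ
    have := DD_V (ee j) (fun l => ee (α l)) (fun a i => pd (σ a) (x i) p) ee
    rw [this]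
    congr 1
    ext1 a
    exact (vec_expand _).symm
  simp_rw [h2]
  rw [sum_eps (fun σ => DD (ee j) (fun a i => pd (σ a) (x i) p) (fun l => ee (α l)))]
  have h3 : ∀ π : Equiv.Perm (Fin (d + 1)), ((Equiv.Perm.sign π : ℤ) : ℝ) *
      DD (ee j) (fun a i => pd (π a) (x i) p) (fun l => ee (α l)) =
      DD (ee j) (fun a i => pd a (x i) p) (fun l => ee (α l)) := by
    intro π
    rw [DD_perm (ee j) (fun a i => pd a (x i) p), ← mul_assoc]
    have : ((Equiv.Perm.sign π : ℤ) : ℝ) * ((Equiv.Perm.sign π : ℤ) : ℝ) = 1 := by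
      rcases Int.units_eq_one_or (Equiv.Perm.sign π) with h | h <;> simp [h]
    rw [this, one_mul]
  simp_rw [h3]
  rw [Finset.sum_const, Finset.card_univ, Fintype.card_perm, Fintype.card_fin, nsmul_eq_mul]
  ring

open Matrix in
lemma CC_sum {d N : ℕ} (g : Matrix (Fin (d + 1)) (Fin (d + 1)) ℝ) (hg : IsUnit g.det)
    (E H : Matrix (Fin N) (Fin (d + 1)) ℝ) (hEH : Eᵀ * H = g)
    (u v : Fin (d + 1) → ℝ) :
    ∑ J : Fin d → Fin N, CC u (fun l => E (J l)) * CC v (fun l => H (J l)) =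
      d.factorial * g.det * ((g⁻¹ *ᵥ u) ⬝ᵥ v) := by
  have hgF : ∀ z : Fin (d + 1) → ℝ, g *ᵥ (g⁻¹ *ᵥ z) = z := by
    intro z
    rw [mulVec_mulVec, mul_nonsing_inv g hg, one_mulVec]
  have h1 : ∀ J : Fin d → Fin N, CC u (fun l => E (J l)) =
      g.det * ∑ c : Fin d → Fin (d + 1), (∏ l, (g⁻¹ *ᵥ E (J l)) (c l)) *
        CC (g⁻¹ *ᵥ u) (fun l => ee (c l)) := by
    intro J
    rw [CC_w (g⁻¹ *ᵥ u) (fun l => g⁻¹ *ᵥ E (J l)) ee, ← CC_mul]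
    simp only [← vec_expand, hgF]
  have h2 : ∀ c : Fin d → Fin (d + 1), ∑ J : Fin d → Fin N,
      (∏ l, (g⁻¹ *ᵥ E (J l)) (c l)) * CC v (fun l => H (J l)) = CC v (fun l => ee (c l)) := by
    intro c
    rw [CC_w v (fun l J => (g⁻¹ *ᵥ E J) (c l)) (fun J => H J)]
    congr 1
    ext l b
    have : (g⁻¹ * (Eᵀ * H)) (c l) b = ee (c l) b := by
      rw [hEH, nonsing_inv_mul g hg]
      simp [ee, Matrix.one_apply, Pi.single_apply, eq_comm]
    rw [← this, ← Matrix.mul_assoc, Matrix.mul_apply, Finset.sum_apply]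
    rfl
  simp_rw [h1]
  have h3 : ∀ J : Fin d → Fin N, (g.det * ∑ c : Fin d → Fin (d + 1),
      (∏ l, (g⁻¹ *ᵥ E (J l)) (c l)) * CC (g⁻¹ *ᵥ u) (fun l => ee (c l))) *
        CC v (fun l => H (J l)) =
      ∑ c : Fin d → Fin (d + 1), g.det * (CC (g⁻¹ *ᵥ u) (fun l => ee (c l)) *
        ((∏ l, (g⁻¹ *ᵥ E (J l)) (c l)) * CC v (fun l => H (J l)))) := by
    intro J
    rw [Finset.mul_sum, Finset.sum_mul]
    refine Finset.sum_congr rfl fun c _ => ?_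
    ring
  simp_rw [h3]
  rw [Finset.sum_comm]
  simp_rw [← Finset.mul_sum, h2, CC_gram]
  ring

lemma nb_cons_eq {d N : ℕ} (ρ : (Fin (d + 1) → ℝ) → ℝ)
    (x : Fin N → (Fin (d + 1) → ℝ) → ℝ) (p : Fin (d + 1) → ℝ) (i : Fin N) (J : Fin d → Fin N) :
    nb ρ (Fin.cons (x i) fun l => x (J l)) p =
      (ρ p)⁻¹ * CC (fun a => pd a (x i) p) (fun l a => pd a (x (J l)) p) := by
  rw [nb_eq, CC, dm_apply]
  congr 3
  ext a b
  refine Fin.cases ?_ (fun a => ?_) a <;> simp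

open Matrix in
lemma P2_formula {d N : ℕ} (ρ : (Fin (d + 1) → ℝ) → ℝ)
    (x : Fin N → (Fin (d + 1) → ℝ) → ℝ) (p : Fin (d + 1) → ℝ)
    (G : Matrix (Fin N) (Fin N) ℝ) (E : Matrix (Fin N) (Fin (d + 1)) ℝ)
    (hE : E = Matrix.of fun i a => pd a (x i) p)
    (g : Matrix (Fin (d + 1)) (Fin (d + 1)) ℝ) (hgE : Eᵀ * (G * E) = g)
    (hg : IsUnit g.det) (hsym : gᵀ = g) (i k : Fin N) :
    ∑ J : Fin d → Fin N, ∑ J' : Fin d → Fin N,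
      ((Real.sqrt (d.factorial : ℝ))⁻¹ * nb ρ (Fin.cons (x i) fun l => x (J l)) p) *
      ((Real.sqrt (d.factorial : ℝ))⁻¹ * nb ρ (Fin.cons (x k) fun l => x (J' l)) p) *
        ∏ l : Fin d, G (J l) (J' l) =
    ((ρ p)⁻¹) ^ 2 * g.det * ((g⁻¹ *ᵥ E i) ⬝ᵥ E k) := by
  have hf : (0 : ℝ) < d.factorial := by exact_mod_cast d.factorial_pos
  have hs : ((Real.sqrt (d.factorial : ℝ))⁻¹) ^ 2 * d.factorial = 1 := by
    rw [inv_pow, Real.sq_sqrt hf.le, inv_mul_cancel₀ hf.ne']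
  have hEi : ∀ i, (fun a => pd a (x i) p) = E i := by intro i; subst hE; rfl
  have hEJ : ∀ J : Fin d → Fin N, (fun l a => pd a (x (J l)) p) = fun l => E (J l) := by
    intro J; subst hE; rfl
  have h1 : ∀ J : Fin d → Fin N, ∑ J' : Fin d → Fin N,
      ((Real.sqrt (d.factorial : ℝ))⁻¹ * nb ρ (Fin.cons (x i) fun l => x (J l)) p) *
      ((Real.sqrt (d.factorial : ℝ))⁻¹ * nb ρ (Fin.cons (x k) fun l => x (J' l)) p) *
        ∏ l : Fin d, G (J l) (J' l) =
      (((Real.sqrt (d.factorial : ℝ))⁻¹) ^ 2 * ((ρ p)⁻¹) ^ 2) *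
        (CC (E i) (fun l => E (J l)) * CC (E k) (fun l => (G * E) (J l))) := by
    intro J
    have h2 : (fun l => (G * E) (J l)) = fun l => ∑ J', G (J l) J' • E J' := by
      ext l b
      rw [Matrix.mul_apply, Finset.sum_apply]; rfl
    rw [h2, ← CC_w (E k) (fun l => G (J l)) (fun J => E J), Finset.mul_sum, Finset.mul_sum]
    refine Finset.sum_congr rfl fun J' _ => ?_
    rw [nb_cons_eq, nb_cons_eq, hEi, hEi, hEJ, hEJ]
    ring
  simp_rw [h1]
  rw [← Finset.mul_sum, CC_sum g hg E (G * E) hgE]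
  linear_combination (((ρ p)⁻¹) ^ 2 * g.det * ((g⁻¹ *ᵥ E i) ⬝ᵥ E k)) * hs

open Matrix in
lemma ZZ_formula {n q : ℕ} (G : Matrix (Fin (n + (q + 1))) (Fin (n + (q + 1))) ℝ)
    (hGs : Gᵀ = G) (hG : IsUnit G.det) (E : Matrix (Fin (n + (q + 1))) (Fin n) ℝ)
    (g : Matrix (Fin n) (Fin n) ℝ) (hgE : Eᵀ * (G * E) = g) (hg : IsUnit g.det)
    (i j : Fin (n + (q + 1))) :
    ∑ α : Fin q → Fin (n + (q + 1)), DD (G⁻¹ i) (fun a => Eᵀ a) (fun l => ee (α l)) *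
      (∑ β : Fin q → Fin (n + (q + 1)), (∏ l : Fin q, G⁻¹ (α l) (β l)) *
        DD (G⁻¹ j) (fun a => Eᵀ a) (fun l => ee (β l))) =
    G.det⁻¹ * q.factorial * g.det * (G⁻¹ i j - (g⁻¹ *ᵥ E j) ⬝ᵥ E i) := by
  have hd : G.det ≠ 0 := isUnit_iff_ne_zero.1 hG
  have hinvs : (G⁻¹)ᵀ = G⁻¹ := by rw [transpose_nonsing_inv, hGs]
  have hrow : ∀ j, G *ᵥ (G⁻¹ j) = ee j := by
    intro j
    have : G⁻¹ j = G⁻¹ *ᵥ ee j := by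
      ext i
      conv_lhs => rw [← hinvs]
      simp [ee]
    rw [this, mulVec_mulVec, mul_nonsing_inv G hG, one_mulVec]
  have h1 : ∀ α : Fin q → Fin (n + (q + 1)),
      (∑ β : Fin q → Fin (n + (q + 1)), (∏ l : Fin q, G⁻¹ (α l) (β l)) *
        DD (G⁻¹ j) (fun a => Eᵀ a) (fun l => ee (β l))) =
      G.det⁻¹ * DD (ee j) (fun a => G *ᵥ Eᵀ a) (fun l => ee (α l)) := by
    intro α
    rw [DD_w (G⁻¹ j) (fun a => Eᵀ a) (fun l => G⁻¹ (α l)) ee, eq_inv_mul_iff_mul_eq₀ hd, ← DD_mul]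
    simp only [← vec_expand, hrow]
  simp_rw [h1]
  have h2 : ∀ α : Fin q → Fin (n + (q + 1)),
      DD (G⁻¹ i) (fun a => Eᵀ a) (fun l => ee (α l)) *
        (G.det⁻¹ * DD (ee j) (fun a => G *ᵥ Eᵀ a) (fun l => ee (α l))) =
      G.det⁻¹ * (DD (G⁻¹ i) (fun a => Eᵀ a) (fun l => ee (α l)) *
        DD (ee j) (fun a => G *ᵥ Eᵀ a) (fun l => ee (α l))) := fun α => by ring
  simp_rw [h2]
  rw [← Finset.mul_sum, DD_gram, bordered_det _ g hg]
  · have e1 : (grm (Fin.cons (G⁻¹ i) (fun a => Eᵀ a) : Fin (n + 1) → _ → ℝ)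
        (Fin.cons (ee j) (fun a => G *ᵥ Eᵀ a) : Fin (n + 1) → _ → ℝ)) 0 0 = G⁻¹ i j := by
      simp [grm, ee]
    have e2 : (fun b : Fin n => (grm (Fin.cons (G⁻¹ i) (fun a => Eᵀ a) : Fin (n + 1) → _ → ℝ)
        (Fin.cons (ee j) (fun a => G *ᵥ Eᵀ a) : Fin (n + 1) → _ → ℝ)) 0 b.succ) = E i := by
      ext b
      simp only [grm, of_apply, Fin.cons_zero, Fin.cons_succ]
      rw [dotProduct_mulVec]
      have : (G⁻¹ i) ᵥ* G = ee i := by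
        rw [← hrow, ← mulVec_transpose, hGs]
      rw [this]
      simp [ee]
    have e3 : (fun a : Fin n => (grm (Fin.cons (G⁻¹ i) (fun a => Eᵀ a) : Fin (n + 1) → _ → ℝ)
        (Fin.cons (ee j) (fun a => G *ᵥ Eᵀ a) : Fin (n + 1) → _ → ℝ)) a.succ 0) = E j := by
      ext b
      simp [grm, ee]
    rw [e1, e2, e3, dotProduct_comm]
    ring
  · intro a b
    rw [← hgE]
    simp only [grm, of_apply, Fin.cons_succ]
    rfl

open scoped Matrix

/-- For `Σ^n ⊂ (M^{n+p}, ḡ)` (here `n = d+1`, `p = q+1`), with the normal vectors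
`Z_α = (γ n! √((p−1)!))⁻¹ ḡ^{ij} ε_{j k₁⋯k_n α}{x^{k₁},…,x^{k_n}} ∂_i` and
`𝒵_α^β = ḡ(Z_α, Z^β)`: (i) `Z^i_α Z^{jα} = ḡ^{ij} − γ⁻²(P²)^{ij}`;
(ii) `𝒵_α^δ 𝒵_δ^β = 𝒵_α^β`; (iii) `𝒵_α^α = p`. -/
theorem Z_projection_props (d q : ℕ)
    (ρ : (Fin (d + 1) → ℝ) → ℝ)
    (x : Fin ((d + 1) + (q + 1)) → (Fin (d + 1) → ℝ) → ℝ)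
    (gbar : (Fin (d + 1) → ℝ) → Matrix (Fin ((d + 1) + (q + 1))) (Fin ((d + 1) + (q + 1))) ℝ)
    (p : Fin (d + 1) → ℝ)
    (hgbar : (gbar p).PosDef)
    (hρ : ρ p ≠ 0)
    (gind : Matrix (Fin (d + 1)) (Fin (d + 1)) ℝ)
    (hgind : gind = Matrix.of fun a c =>
      ∑ i, ∑ j, gbar p i j * pd a (x i) p * pd c (x j) p)
    (hgpos : 0 < gind.det)
    (γ : ℝ) (hγ : γ = Real.sqrt gind.det / ρ p)
    (Z : (Fin q → Fin ((d + 1) + (q + 1))) → Fin ((d + 1) + (q + 1)) → ℝ)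
    (hZ : Z = fun α i => (γ * ((d + 1).factorial : ℝ) * Real.sqrt (q.factorial : ℝ))⁻¹ *
      ∑ j, (gbar p)⁻¹ i j *
        ∑ k : Fin (d + 1) → Fin ((d + 1) + (q + 1)),
          (Real.sqrt (gbar p).det * eps (Fin.cons j (Fin.append k α))) *
            nb ρ (fun l => x (k l)) p)
    -- `Z` with the multi-index raised by `ḡ⁻¹`
    (Zup : Fin ((d + 1) + (q + 1)) → (Fin q → Fin ((d + 1) + (q + 1))) → ℝ)
    (hZup : Zup = fun j α => ∑ β : Fin q → Fin ((d + 1) + (q + 1)),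
      (∏ l : Fin q, (gbar p)⁻¹ (α l) (β l)) * Z β j)
    (Pm : Fin ((d + 1) + (q + 1)) → (Fin d → Fin ((d + 1) + (q + 1))) → ℝ)
    (hPm : Pm = fun i J => (Real.sqrt (d.factorial : ℝ))⁻¹ *
      nb ρ (Fin.cons (x i) fun l => x (J l)) p)
    (P2up : Fin ((d + 1) + (q + 1)) → Fin ((d + 1) + (q + 1)) → ℝ)
    (hP2up : P2up = fun i k => ∑ J : Fin d → Fin ((d + 1) + (q + 1)),
      ∑ J' : Fin d → Fin ((d + 1) + (q + 1)),
        Pm i J * Pm k J' * ∏ l : Fin d, gbar p (J l) (J' l))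
    (Zmat : (Fin q → Fin ((d + 1) + (q + 1))) → (Fin q → Fin ((d + 1) + (q + 1))) → ℝ)
    (hZmat : Zmat = fun α β => ∑ i, ∑ j, gbar p i j * Z α i * Zup j β) :
    (∀ i j, ∑ α : Fin q → Fin ((d + 1) + (q + 1)), Z α i * Zup j α =
      (gbar p)⁻¹ i j - (γ ^ 2)⁻¹ * P2up i j) ∧
    (∀ α β, ∑ δ : Fin q → Fin ((d + 1) + (q + 1)), Zmat α δ * Zmat δ β = Zmat α β) ∧
    (∑ α : Fin q → Fin ((d + 1) + (q + 1)), Zmat α α = (q : ℝ) + 1) := by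
  have hdG : 0 < (gbar p).det := hgbar.det_pos
  have hGs : (gbar p)ᵀ = gbar p := by
    have := hgbar.isHermitian
    rwa [Matrix.IsHermitian, Matrix.conjTranspose_eq_transpose_of_trivial] at this
  generalize gbar p = G at *
  have hG : IsUnit G.det := isUnit_iff_ne_zero.2 hdG.ne'
  have hg : IsUnit gind.det := isUnit_iff_ne_zero.2 hgpos.ne'
  obtain ⟨E, hE⟩ : ∃ E : Matrix (Fin ((d + 1) + (q + 1))) (Fin (d + 1)) ℝ,
    E = Matrix.of fun i a => pd a (x i) p := ⟨_, rfl⟩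
  have hgE : Eᵀ * (G * E) = gind := by
    subst hE hgind
    ext a c
    simp only [Matrix.mul_apply, Matrix.transpose_apply, Matrix.of_apply, Finset.mul_sum]
    refine Finset.sum_congr rfl fun i _ => Finset.sum_congr rfl fun j _ => ?_
    ring
  have hgs : gindᵀ = gind := by
    rw [← hgE, Matrix.transpose_mul, Matrix.transpose_mul, Matrix.transpose_transpose, hGs,
      Matrix.mul_assoc]
  have hq : (0 : ℝ) < q.factorial := by exact_mod_cast q.factorial_pos
  have hd' : ((d + 1).factorial : ℝ) ≠ 0 := by exact_mod_cast (d + 1).factorial_ne_zero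
  have hγρ : γ ^ 2 * ρ p ^ 2 = gind.det := by
    rw [hγ, div_pow, Real.sq_sqrt hgpos.le]; field_simp
  have hγ0 : γ ≠ 0 := by
    rintro rfl
    simp at hγρ; exact hgpos.ne hγρ
  obtain ⟨K, hK⟩ : ∃ K, K = Real.sqrt G.det * (γ * ρ p * Real.sqrt (q.factorial : ℝ))⁻¹ :=
    ⟨_, rfl⟩
  have hK2 : K * K * (G.det⁻¹ * q.factorial * gind.det) = 1 := by
    have : K * K = G.det * (gind.det * q.factorial)⁻¹ := by
      rw [← hγρ, hK]
      have h1 := Real.mul_self_sqrt hdG.le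
      have h2 := Real.mul_self_sqrt hq.le
      calc _ = (Real.sqrt G.det * Real.sqrt G.det) * (γ ^ 2 * ρ p ^ 2 *
            (Real.sqrt (q.factorial : ℝ) * Real.sqrt (q.factorial : ℝ)))⁻¹ := by
            simp only [mul_inv]; ring
        _ = _ := by rw [h1, h2]
    rw [this]
    field_simp
  have hZ1 : ∀ α i, Z α i = K * ∑ j, G⁻¹ i j * DD (ee j) (fun a => Eᵀ a) (fun l => ee (α l)) := by
    intro α i
    rw [hZ]
    simp only [sum_eps_nb]
    have hV : (fun a i => pd a (x i) p) = fun a => Eᵀ a := by subst hE; rfl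
    rw [hV, hK, Finset.mul_sum, Finset.mul_sum]
    refine Finset.sum_congr rfl fun j _ => ?_
    simp only [mul_inv]
    field_simp
  have hZ2 : ∀ α i, Z α i = K * DD (G⁻¹ i) (fun a => Eᵀ a) (fun l => ee (α l)) := by
    intro α i
    rw [hZ1, DD_u (G⁻¹ i)]
  have hi : ∀ i j, ∑ α : Fin q → Fin ((d + 1) + (q + 1)), Z α i * Zup j α =
      G⁻¹ i j - (gind⁻¹ *ᵥ E j) ⬝ᵥ E i := by
    intro i j
    have h := ZZ_formula (n := d + 1) G hGs hG E gind hgE hg i j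
    have : ∀ α, Z α i * Zup j α = K * K *
      (DD (G⁻¹ i) (fun a => Eᵀ a) (fun l => ee (α l)) *
      (∑ β : Fin q → Fin ((d + 1) + (q + 1)), (∏ l : Fin q, G⁻¹ (α l) (β l)) *
        DD (G⁻¹ j) (fun a => Eᵀ a) (fun l => ee (β l)))) := by
      intro α
      rw [hZup]
      simp only [hZ2, Finset.mul_sum]
      refine Finset.sum_congr rfl fun β _ => ?_
      ring
    simp_rw [this]
    rw [← Finset.mul_sum, h, ← mul_assoc, hK2, one_mul]
  have hinvs : (G⁻¹)ᵀ = G⁻¹ := by rw [Matrix.transpose_nonsing_inv, hGs]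
  have hginvs : (gind⁻¹)ᵀ = gind⁻¹ := by rw [Matrix.transpose_nonsing_inv, hgs]
  have hswap : ∀ i j, (gind⁻¹ *ᵥ E j) ⬝ᵥ E i = (gind⁻¹ *ᵥ E i) ⬝ᵥ E j := by
    intro i j
    rw [dotProduct_comm, Matrix.dotProduct_mulVec, ← Matrix.mulVec_transpose, hginvs]
  let Zm : Matrix (Fin q → Fin ((d + 1) + (q + 1))) (Fin ((d + 1) + (q + 1))) ℝ := Matrix.of Z
  let ZU : Matrix (Fin ((d + 1) + (q + 1))) (Fin q → Fin ((d + 1) + (q + 1))) ℝ := Matrix.of Zup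
  have hUZ : ZU * Zm = G⁻¹ - E * gind⁻¹ * Eᵀ := by
    ext j i
    have h1 : (ZU * Zm) j i = ∑ α, Z α i * Zup j α := by
      rw [Matrix.mul_apply]
      exact Finset.sum_congr rfl fun α _ => mul_comm _ _
    have h2 : (E * gind⁻¹ * Eᵀ) j i = (gind⁻¹ *ᵥ E i) ⬝ᵥ E j := by
      rw [Matrix.mul_assoc, dotProduct_comm]
      rfl
    rw [h1, hi, Matrix.sub_apply, h2, hswap]
    congr 1
    conv_lhs => rw [← hinvs]
    rfl
  have hM : Zm * G * ZU = Matrix.of Zmat := by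
    ext α β
    rw [hZmat]
    simp only [Matrix.mul_apply, Matrix.of_apply, Finset.sum_mul, Zm, ZU]
    rw [Finset.sum_comm]
    refine Finset.sum_congr rfl fun i _ => Finset.sum_congr rfl fun j _ => ?_
    ring
  have hZGE : Zm * G * E = 0 := by
    let Dm : Matrix (Fin q → Fin ((d + 1) + (q + 1))) (Fin ((d + 1) + (q + 1))) ℝ :=
      Matrix.of fun α j => DD (ee j) (fun a => Eᵀ a) (fun l => ee (α l))
    have h1 : Zm = K • (Dm * (G⁻¹)ᵀ) := by
      ext α i
      simp only [Zm, Dm, Matrix.of_apply, Matrix.smul_apply, Matrix.mul_apply,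
        Matrix.transpose_apply, smul_eq_mul, hZ1]
      congr 1
      exact Finset.sum_congr rfl fun j _ => mul_comm _ _
    have h2 : Dm * E = 0 := by
      ext α a
      have := DD_eq_zero (n := d + 1) (fun a => Eᵀ a) (fun l => ee (α l)) a
      rw [← DD_u] at this
      rw [Matrix.mul_apply, Matrix.zero_apply, ← this]
      exact Finset.sum_congr rfl fun j _ => mul_comm _ _
    rw [h1, hinvs, Matrix.smul_mul, Matrix.smul_mul, Matrix.mul_assoc Dm,
      Matrix.nonsing_inv_mul G hG, Matrix.mul_one, h2, smul_zero]
  refine ⟨?_, ?_, ?_⟩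
  · intro i j
    rw [hi, hP2up]
    simp only [hPm]
    rw [P2_formula ρ x p G E hE gind hgE hg hgs, hswap, ← hγρ]
    field_simp
  · intro α β
    have h : (Zm * G * ZU) * (Zm * G * ZU) = Zm * G * ZU := by
      calc (Zm * G * ZU) * (Zm * G * ZU) = Zm * G * (ZU * Zm) * (G * ZU) := by
            simp only [Matrix.mul_assoc]
        _ = (Zm * G * G⁻¹ - (Zm * G * E) * gind⁻¹ * Eᵀ) * (G * ZU) := by
            rw [hUZ, Matrix.mul_sub]
            simp only [Matrix.mul_assoc]
        _ = _ := by
            rw [hZGE, Matrix.zero_mul, Matrix.zero_mul, sub_zero, Matrix.mul_assoc Zm,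
              Matrix.mul_nonsing_inv G hG, Matrix.mul_one, Matrix.mul_assoc]
    rw [hM] at h
    exact congrFun (congrFun h α) β
  · have h : Matrix.trace (Zm * G * ZU) = (q : ℝ) + 1 := by
      rw [Matrix.mul_assoc, Matrix.trace_mul_comm, Matrix.mul_assoc, hUZ, Matrix.mul_sub,
        Matrix.trace_sub, Matrix.mul_nonsing_inv G hG, Matrix.trace_one]
      have : Matrix.trace (G * (E * gind⁻¹ * Eᵀ)) = (d : ℝ) + 1 := by
        rw [← Matrix.mul_assoc, Matrix.trace_mul_comm, ← Matrix.mul_assoc G,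
          ← Matrix.mul_assoc, hgE, Matrix.mul_nonsing_inv gind hg, Matrix.trace_one]
        simp
      rw [this]
      simp
    rw [hM] at h
    exact h
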